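/- Let (𝒜, μ_A) be a finite probability space with minimum nonzero atom probability α = α(μ_A) ≤ 1/2, let P : 𝒜^n → ℝ have degree at most d, let H ⊆ [n] with T = [n]∖H, and let ξ ∼ μ_A^{⊗H} be a random restriction of the coordinates in H. Then for every r ≥ e^d and every i ∈ T, Pr_ξ[ Inf_i(P_ξ) > r · C₄(α)^d · Inf_i(P) ] ≤ exp(−c·r^{1/d}), where c = α·d/e. -/

import Mathlib

open Finset MeasureTheory ProbabilityTheory Filter
open scoped Classical

noncomputable section

namespace NIS

/-- Expectation of `f` under the weight function `p` on a finite type. -/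
def pmean {Ω : Type*} [Fintype Ω] (p : Ω → ℝ) (f : Ω → ℝ) : ℝ := ∑ ω, p ω * f ω

/-- Variance of `f` under the weight function `p` on a finite type. -/
def pvar {Ω : Type*} [Fintype Ω] (p : Ω → ℝ) (f : Ω → ℝ) : ℝ :=
  pmean p (fun ω => (f ω - pmean p f) ^ 2)

/-- `p` is a probability distribution on the finite type `Ω`. -/
def IsDist {Ω : Type*} [Fintype Ω] (p : Ω → ℝ) : Prop :=
  (∀ ω, 0 ≤ p ω) ∧ ∑ ω, p ω = 1

/-- Probability of the event `E` under the weight function `p`. -/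
def pprob {Ω : Type*} [Fintype Ω] (p : Ω → ℝ) (E : Ω → Prop) : ℝ :=
  ∑ ω, if E ω then p ω else 0

/-- Total variation distance between two distributions on a finite type. -/
def tvDist {Ω : Type*} [Fintype Ω] (p q : Ω → ℝ) : ℝ := (1 / 2) * ∑ ω, |p ω - q ω|

/-- Marginal on the first coordinate of a joint distribution. -/
def marginalA {A B : Type*} [Fintype A] [Fintype B] (μ : A × B → ℝ) : A → ℝ :=
  fun a => ∑ b, μ (a, b)

/-- Marginal on the second coordinate of a joint distribution. -/
def marginalB {A B : Type*} [Fintype A] [Fintype B] (μ : A × B → ℝ) : B → ℝ :=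
  fun b => ∑ a, μ (a, b)

/-- The Hirschfeld–Gebelein–Rényi maximal correlation of a finite joint distribution. -/
def maxCorr {A B : Type*} [Fintype A] [Fintype B] (μ : A × B → ℝ) : ℝ :=
  sSup { r | ∃ f : A → ℝ, ∃ g : B → ℝ,
    pmean (marginalA μ) f = 0 ∧ pmean (marginalB μ) g = 0 ∧
    pvar (marginalA μ) f = 1 ∧ pvar (marginalB μ) g = 1 ∧
    pmean μ (fun ab => f ab.1 * g ab.2) = r }

/-- `n`-fold product distribution of a distribution `μA` on `A`. -/
def prodDist {A : Type*} [Fintype A] (μA : A → ℝ) (n : ℕ) : (Fin n → A) → ℝ :=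
  fun x => ∏ i, μA (x i)

/-- `n`-fold product of a joint distribution `μ` on `A × B`, identified with a distribution on
`A^n × B^n`. -/
def prodPair {A B : Type*} [Fintype A] [Fintype B] (μ : A × B → ℝ) (n : ℕ) :
    (Fin n → A) × (Fin n → B) → ℝ :=
  fun p => ∏ i, μ (p.1 i, p.2 i)

/-- The influence of coordinate `i` on `f : A^n → ℝ` with respect to `μA^{⊗n}`:
`Inf_i(f) = E_{x_{-i}}[Var_{x_i} f] = ½ E_{x, a}[(f(x) - f(x_i ← a))²]`. -/
def influence {A : Type*} [Fintype A] {n : ℕ} (μA : A → ℝ) (i : Fin n)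
    (f : (Fin n → A) → ℝ) : ℝ :=
  (1 / 2) * ∑ x : Fin n → A, ∑ a : A,
    (∏ j, μA (x j)) * μA a * (f x - f (Function.update x i a)) ^ 2

/-- Total influence of `f`. -/
def totalInfluence {A : Type*} [Fintype A] {n : ℕ} (μA : A → ℝ)
    (f : (Fin n → A) → ℝ) : ℝ :=
  ∑ i, influence μA i f

/-- `g` depends on at most `d` coordinates. -/
def DependsOnLE {A : Type*} {n : ℕ} (d : ℕ) (g : (Fin n → A) → ℝ) : Prop :=
  ∃ J : Finset (Fin n), J.card ≤ d ∧
    ∀ x y : Fin n → A, (∀ i ∈ J, x i = y i) → g x = g y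

/-- `f` has degree at most `d`: it lies in the linear span of functions each depending on at
most `d` coordinates. -/
def degLE {A : Type*} {n : ℕ} (d : ℕ) (f : (Fin n → A) → ℝ) : Prop :=
  f ∈ Submodule.span ℝ { g : (Fin n → A) → ℝ | DependsOnLE d g }

/-- Restriction of `P` fixing the coordinates in `H` to the values of `ξ`; the result only
depends on the coordinates outside `H`. -/
def restrictFn {A : Type*} {n : ℕ} (H : Finset (Fin n)) (ξ : Fin n → A)
    (P : (Fin n → A) → ℝ) : (Fin n → A) → ℝ :=
  fun x => P (fun i => if i ∈ H then ξ i else x i)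

/-- The 2-dimensional Gaussian distribution `G(ρ)` with standard normal marginals and
correlation `ρ`. -/
def gauss2 (ρ : ℝ) : Measure (ℝ × ℝ) :=
  Measure.map (fun p : ℝ × ℝ => (p.1, ρ * p.1 + Real.sqrt (1 - ρ ^ 2) * p.2))
    ((gaussianReal 0 1).prod (gaussianReal 0 1))

/-- The standard normal cumulative distribution function `Φ`. -/
def stdNormalCDF (t : ℝ) : ℝ := ((gaussianReal 0 1) (Set.Iic t)).toReal

/-- The inverse `Φ⁻¹` of the standard normal CDF (junk values outside `(0,1)`). -/
def stdNormalCDFInv : ℝ → ℝ := Function.invFun stdNormalCDF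

/-- The ±1-valued threshold function: `thr t r = 1` if `r ≥ t`, and `-1` otherwise. -/
def thr (t r : ℝ) : ℝ := if t ≤ r then 1 else -1

/-- The Gaussian stability quantity `Γ̄_ρ(m, v)`. -/
def Gammabar (ρ m v : ℝ) : ℝ :=
  ∫ q : ℝ × ℝ, (if q.1 ≤ stdNormalCDFInv ((1 + m) / 2) then (1 : ℝ) else -1) *
    (if q.2 ≤ stdNormalCDFInv ((1 + v) / 2) then (1 : ℝ) else -1) ∂(gauss2 ρ)

/-- Pushforward of `μ^{⊗n}` under the pair of maps `(f, g)`. -/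
def push {A B U V : Type*} [Fintype A] [Fintype B] (μ : A × B → ℝ) (n : ℕ)
    (f : (Fin n → A) → U) (g : (Fin n → B) → V) : U × V → ℝ :=
  fun uv => ∑ z : Fin n → A × B,
    if f (fun i => (z i).1) = uv.1 ∧ g (fun i => (z i).2) = uv.2
    then ∏ i, μ (z i) else 0

/-- `ν` can be non-interactively simulated from `μ`. -/
def CanSimulate {A B U V : Type*} [Fintype A] [Fintype B] [Fintype U] [Fintype V]
    (μ : A × B → ℝ) (ν : U × V → ℝ) : Prop :=
  ∃ f : (n : ℕ) → (Fin n → A) → U, ∃ g : (n : ℕ) → (Fin n → B) → V,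
    Tendsto (fun n => tvDist (push μ n (f n) (g n)) ν) atTop (nhds 0)

/-- The doubly symmetric binary source `DSBS(ρ)`, as a distribution on `Bool × Bool`, where
`true` encodes `+1` and `false` encodes `-1`. -/
def DSBS (ρ : ℝ) : Bool × Bool → ℝ :=
  fun bv => if bv.1 = bv.2 then (1 + ρ) / 4 else (1 - ρ) / 4

/-- The ±1 value encoded by a Boolean. -/
def sgn (b : Bool) : ℝ := if b then 1 else -1

/-- Minimum nonzero probability of an atom. -/
def minAtom {A : Type*} [Fintype A] (μA : A → ℝ) : ℝ :=
  sInf { x | ∃ a, μA a = x ∧ 0 < x }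

/-- The hypercontractivity constant `C₄(α)`. -/
def C4 (α : ℝ) : ℝ :=
  if α = 1 / 2 then 3 else
    (((1 - α) / α) ^ ((3 : ℝ) / 4) - ((1 - α) / α) ^ (-((3 : ℝ) / 4))) /
    (((1 - α) / α) ^ ((1 : ℝ) / 4) - ((1 - α) / α) ^ (-((1 : ℝ) / 4)))

/-! ### Elementary inequalities -/

lemma pow_mul_add_le_add_pow {a t : ℝ} (ha : 0 ≤ a) (ht : 0 ≤ a + t) (m : ℕ) :
    a ^ m * (a + (m + 1) * t) ≤ (a + t) ^ (m + 1) := by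
  induction m with
  | zero => simp
  | succ k ih =>
    have h : (a + t) * (a ^ k * (a + (k + 1) * t)) ≤ (a + t) * (a + t) ^ (k + 1) :=
      mul_le_mul_of_nonneg_left ih ht
    have h2 : 0 ≤ a ^ k * ((k + 1) * t ^ 2) := by positivity
    push_cast
    calc a ^ (k + 1) * (a + (k + 1 + 1) * t)
        = (a + t) * (a ^ k * (a + (k + 1) * t)) - a ^ k * ((k + 1) * t ^ 2) := by ring
      _ ≤ (a + t) * (a + t) ^ (k + 1) := by linarith
      _ = _ := by ring

lemma sub_mul_pow_sub_pow_nonneg {a b : ℝ} (ha : 0 ≤ a) (hb : 0 ≤ b) (m : ℕ) :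
    0 ≤ (a - b) * (a ^ m - b ^ m) := by
  rcases le_total a b with h | h
  · exact mul_nonneg_of_nonpos_of_nonpos (by linarith)
      (by linarith [pow_le_pow_left₀ ha h m])
  · exact mul_nonneg (by linarith) (by linarith [pow_le_pow_left₀ hb h m])

lemma sq_sub_sq_mul_le (p q : ℝ) (m : ℕ) :
    (p ^ 2 - q ^ 2) * ((p ^ 2) ^ m - (q ^ 2) ^ m) ≤
      2 * m * (p - q) ^ 2 * ((p ^ 2) ^ m + (q ^ 2) ^ m) := by
  induction m with
  | zero => simp
  | succ k ih =>
    have hL := sub_mul_pow_sub_pow_nonneg (sq_nonneg p) (sq_nonneg q) k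
    set X := (p ^ 2) ^ k with hX
    set Y := (q ^ 2) ^ k with hY
    have hS : 0 ≤ X + Y := by positivity
    have h1 : (p ^ 2 + q ^ 2) * ((p ^ 2 - q ^ 2) * (X - Y)) ≤
        (p ^ 2 + q ^ 2) * (2 * k * (p - q) ^ 2 * (X + Y)) :=
      mul_le_mul_of_nonneg_left ih (by positivity)
    have h2 : 0 ≤ (p - q) ^ 2 * (p - q) ^ 2 * (X + Y) := by positivity
    have h3 : 0 ≤ (k + 1 : ℝ) * (p - q) ^ 2 * ((p ^ 2 - q ^ 2) * (X - Y)) := by positivity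
    rw [pow_succ _ k, pow_succ _ k, ← hX, ← hY]
    push_cast
    nlinarith [h1, h2, h3]

/-- The two-point hypercontractive inequality for even integer exponents. -/
lemma two_point (m : ℕ) (u x : ℝ) :
    (u + x) ^ (2 * (m + 1)) + (u - x) ^ (2 * (m + 1)) ≤
      2 * (u ^ 2 + (2 * m + 1) * x ^ 2) ^ (m + 1) := by
  induction m with
  | zero => apply le_of_eq; simp; ring
  | succ k ih =>
    have hD := sq_sub_sq_mul_le (u + x) (u - x) (k + 1)
    have hB := pow_mul_add_le_add_pow (a := u ^ 2 + (2 * k + 1) * x ^ 2) (t := 2 * x ^ 2)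
      (by positivity) (by positivity) (k + 1)
    rw [pow_mul, pow_mul] at ih ⊢
    rw [pow_succ _ (k + 1), pow_succ _ (k + 1)]
    push_cast at hD hB ⊢
    set X := ((u + x) ^ 2) ^ (k + 1)
    set Y := ((u - x) ^ 2) ^ (k + 1)
    have h1 := mul_le_mul_of_nonneg_left ih
      (show (0 : ℝ) ≤ u ^ 2 + (4 * k + 5) * x ^ 2 by positivity)
    have e1 : u ^ 2 + (2 * ((k : ℝ) + 1) + 1) * x ^ 2 =
        u ^ 2 + (2 * k + 1) * x ^ 2 + 2 * x ^ 2 := by ring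
    rw [e1]
    set Z := (u ^ 2 + (2 * (k : ℝ) + 1) * x ^ 2) ^ (k + 1)
    nlinarith [hD, h1, hB]

/-- Even powers lie above their tangent lines. -/
lemma tangent_le_even_pow (m : ℕ) (u x : ℝ) :
    u ^ (2 * (m + 1)) + 2 * (m + 1) * u ^ (2 * m + 1) * x ≤ (u + x) ^ (2 * (m + 1)) := by
  have h := pow_mul_add_le_add_pow (a := u ^ 2) (t := 2 * u * x + x ^ 2) (sq_nonneg u)
    (by nlinarith [sq_nonneg (u + x)]) m
  have e : u ^ 2 + (2 * u * x + x ^ 2) = (u + x) ^ 2 := by ring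
  rw [e, ← pow_mul (u + x)] at h
  have h0 : 0 ≤ (u ^ 2) ^ m * ((m + 1) * x ^ 2) := by positivity
  calc u ^ (2 * (m + 1)) + 2 * (m + 1) * u ^ (2 * m + 1) * x
      = (u ^ 2) ^ m * (u ^ 2 + (m + 1) * (2 * u * x + x ^ 2)) -
        (u ^ 2) ^ m * ((m + 1) * x ^ 2) := by ring
    _ ≤ (u + x) ^ (2 * (m + 1)) := by linarith

/-- The one-variable hypercontractive inequality. -/
lemma one_variable {A : Type*} [Fintype A] {p : A → ℝ} (hp : IsDist p) {α : ℝ} (hα : 0 < α)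
    (hα2 : α ≤ 1 / 2) (hmin : ∀ a, p a = 0 ∨ α ≤ p a) (X : A → ℝ) (hX : pmean p X = 0)
    (u : ℝ) (m : ℕ) :
    pmean p (fun a => (u + X a) ^ (2 * (m + 1))) ≤
      (u ^ 2 + (2 * m + 1) / α * pmean p (fun a => X a ^ 2)) ^ (m + 1) := by
  obtain ⟨hp0, hp1⟩ := hp
  set V := pmean p (fun a => X a ^ 2) with hV
  have hV0 : 0 ≤ V := Finset.sum_nonneg fun a _ => mul_nonneg (hp0 a) (sq_nonneg _)
  set W := (u ^ 2 + (2 * m + 1) / α * V) ^ (m + 1) with hW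
  set U := (u ^ 2) ^ (m + 1) with hU
  have hUW : U ≤ W := pow_le_pow_left₀ (sq_nonneg u) (le_add_of_nonneg_right (by positivity)) _
  have key : ∀ a, p a * (u + X a) ^ (2 * (m + 1)) ≤
      2 * (m + 1) * u ^ (2 * m + 1) * (p a * X a) + U * p a
        + 2 * (W - U) * (p a * (X a ^ 2 / (V / α))) := by
    intro a
    rcases hmin a with h | h
    · simp [h]
    have hXV : α * X a ^ 2 ≤ V :=
      (mul_le_mul_of_nonneg_right h (sq_nonneg _)).trans
        (Finset.single_le_sum (f := fun a => p a * X a ^ 2)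
          (fun a _ => mul_nonneg (hp0 a) (sq_nonneg _)) (Finset.mem_univ a))
    have hb : X a ^ 2 ≤ V / α := by rw [le_div_iff₀ hα]; linarith
    set l := X a ^ 2 / (V / α) with hl
    have hl0 : 0 ≤ l := by positivity
    have hl1 : l ≤ 1 := div_le_one_of_le₀ hb (by positivity)
    have hlX : X a ^ 2 = l * (V / α) := by
      rcases eq_or_ne (V / α) 0 with h0 | h0
      · rw [h0, mul_zero]; exact le_antisymm (h0 ▸ hb) (sq_nonneg _)
      · rw [hl, div_mul_cancel₀ _ h0]
    have hc := (convexOn_pow (𝕜 := ℝ) (m + 1)).2 (Set.mem_Ici.2 (sq_nonneg u))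
      (Set.mem_Ici.2 (show 0 ≤ u ^ 2 + (2 * m + 1) / α * V by positivity))
      (sub_nonneg.2 hl1) hl0 (by ring)
    simp only [smul_eq_mul] at hc
    have e : (1 - l) * u ^ 2 + l * (u ^ 2 + (2 * m + 1) / α * V) =
        u ^ 2 + (2 * m + 1) * X a ^ 2 := by rw [hlX]; ring
    rw [e, ← hU, ← hW] at hc
    have ht := two_point m u (X a)
    have hb := tangent_le_even_pow m u (-X a)
    rw [← sub_eq_add_neg] at hb
    have eU : u ^ (2 * (m + 1)) = U := by rw [hU, pow_mul]
    rw [eU] at hb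
    have hfin : (u + X a) ^ (2 * (m + 1)) ≤
        2 * (m + 1) * u ^ (2 * m + 1) * X a + U + 2 * (W - U) * l := by nlinarith
    calc p a * (u + X a) ^ (2 * (m + 1)) ≤
        p a * (2 * (m + 1) * u ^ (2 * m + 1) * X a + U + 2 * (W - U) * l) :=
          mul_le_mul_of_nonneg_left hfin (hp0 a)
      _ = _ := by ring
  have hl : ∑ a, p a * (X a ^ 2 / (V / α)) ≤ α := by
    have : ∑ a, p a * (X a ^ 2 / (V / α)) = V / (V / α) := by
      simp only [← mul_div_assoc, ← Finset.sum_div]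
      rfl
    rw [this, div_div_eq_mul_div]
    rcases eq_or_ne V 0 with h0 | h0
    · simp [h0, hα.le]
    · rw [mul_div_cancel_left₀ _ h0]
  have hX' : ∑ a, p a * X a = 0 := hX
  calc pmean p (fun a => (u + X a) ^ (2 * (m + 1)))
      ≤ ∑ a, (2 * (m + 1) * u ^ (2 * m + 1) * (p a * X a) + U * p a
        + 2 * (W - U) * (p a * (X a ^ 2 / (V / α)))) := Finset.sum_le_sum fun a _ => key a
    _ = U + 2 * (W - U) * ∑ a, p a * (X a ^ 2 / (V / α)) := by
      rw [Finset.sum_add_distrib, Finset.sum_add_distrib, ← Finset.mul_sum, ← Finset.mul_sum,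
        ← Finset.mul_sum, hX', hp1]
      ring
    _ ≤ W := by nlinarith [mul_le_mul_of_nonneg_left hl (sub_nonneg.2 hUW)]

/-! ### Minkowski's inequality for moments -/

lemma minkowski_two {Ω : Type*} [Fintype Ω] {p : Ω → ℝ} (hp : ∀ ω, 0 ≤ p ω) {h k : Ω → ℝ}
    (hh : ∀ ω, 0 ≤ h ω) (hk : ∀ ω, 0 ≤ k ω) {M N : ℝ} (hM : 0 ≤ M) (hN : 0 ≤ N) (m : ℕ)
    (hhM : pmean p (fun ω => h ω ^ (m + 1)) ≤ M ^ (m + 1))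
    (hkN : pmean p (fun ω => k ω ^ (m + 1)) ≤ N ^ (m + 1)) :
    pmean p (fun ω => (h ω + k ω) ^ (m + 1)) ≤ (M + N) ^ (m + 1) := by
  have vanish : ∀ g : Ω → ℝ, (∀ ω, 0 ≤ g ω) → pmean p (fun ω => g ω ^ (m + 1)) ≤ 0 →
      ∀ ω, p ω = 0 ∨ g ω = 0 := by
    intro g hg h0 ω
    have hnn : ∀ ω ∈ Finset.univ, 0 ≤ p ω * g ω ^ (m + 1) :=
      fun ω _ => mul_nonneg (hp ω) (pow_nonneg (hg ω) _)
    have := (Finset.sum_eq_zero_iff_of_nonneg hnn).1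
      (le_antisymm h0 (Finset.sum_nonneg hnn)) ω (Finset.mem_univ ω)
    rcases mul_eq_zero.1 this with h | h
    · exact Or.inl h
    · exact Or.inr (pow_eq_zero_iff (Nat.succ_ne_zero m) |>.1 h)
  rcases hM.eq_or_lt with rfl | hM
  · have hv := vanish h hh (by simpa using hhM)
    rw [zero_add]
    refine le_trans (le_of_eq (Finset.sum_congr rfl fun ω _ => ?_)) hkN
    rcases hv ω with h | h <;> simp [h]
  rcases hN.eq_or_lt with rfl | hN
  · have hv := vanish k hk (by simpa using hkN)
    rw [add_zero]
    refine le_trans (le_of_eq (Finset.sum_congr rfl fun ω _ => ?_)) hhM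
    rcases hv ω with h | h <;> simp [h]
  have hMN : 0 < M + N := by linarith
  have key : ∀ ω, p ω * (h ω + k ω) ^ (m + 1) ≤
      (M + N) ^ (m + 1) * (M / (M + N) / M ^ (m + 1)) * (p ω * h ω ^ (m + 1)) +
      (M + N) ^ (m + 1) * (N / (M + N) / N ^ (m + 1)) * (p ω * k ω ^ (m + 1)) := by
    intro ω
    have hc := (convexOn_pow (𝕜 := ℝ) (m + 1)).2
      (Set.mem_Ici.2 (div_nonneg (hh ω) hM.le)) (Set.mem_Ici.2 (div_nonneg (hk ω) hN.le))
      (show 0 ≤ M / (M + N) by positivity) (show 0 ≤ N / (M + N) by positivity)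
      (by field_simp)
    simp only [smul_eq_mul] at hc
    have e : M / (M + N) * (h ω / M) + N / (M + N) * (k ω / N) = (h ω + k ω) / (M + N) := by
      field_simp
    rw [e, div_pow, div_pow, div_pow, div_le_iff₀ (by positivity)] at hc
    calc p ω * (h ω + k ω) ^ (m + 1) ≤ p ω * _ := mul_le_mul_of_nonneg_left hc (hp ω)
      _ = _ := by ring
  calc pmean p (fun ω => (h ω + k ω) ^ (m + 1)) ≤ _ := Finset.sum_le_sum fun ω _ => key ω
    _ = (M + N) ^ (m + 1) * (M / (M + N) / M ^ (m + 1)) * pmean p (fun ω => h ω ^ (m + 1)) +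
      (M + N) ^ (m + 1) * (N / (M + N) / N ^ (m + 1)) * pmean p (fun ω => k ω ^ (m + 1)) := by
      rw [Finset.sum_add_distrib, ← Finset.mul_sum, ← Finset.mul_sum]; rfl
    _ ≤ (M + N) ^ (m + 1) * (M / (M + N) / M ^ (m + 1)) * M ^ (m + 1) +
      (M + N) ^ (m + 1) * (N / (M + N) / N ^ (m + 1)) * N ^ (m + 1) := by gcongr
    _ = (M + N) ^ (m + 1) := by field_simp

lemma minkowski_sum {Ω ι : Type*} [Fintype Ω] {p : Ω → ℝ} (hp : ∀ ω, 0 ≤ p ω)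
    {h : ι → Ω → ℝ} (hh : ∀ k ω, 0 ≤ h k ω) {N : ι → ℝ} (hN : ∀ k, 0 ≤ N k) (m : ℕ)
    (hhN : ∀ k, pmean p (fun ω => h k ω ^ (m + 1)) ≤ N k ^ (m + 1)) (s : Finset ι) :
    pmean p (fun ω => (∑ k ∈ s, h k ω) ^ (m + 1)) ≤ (∑ k ∈ s, N k) ^ (m + 1) := by
  induction s using Finset.induction_on with
  | empty => simp [pmean]
  | insert a s ha ih =>
    simp only [Finset.sum_insert ha]
    exact minkowski_two hp (hh a) (fun ω => Finset.sum_nonneg fun k _ => hh k ω) (hN a)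
      (Finset.sum_nonneg fun k _ => hN k) m (hhN a) ih

lemma pmean_mul_left {Ω : Type*} [Fintype Ω] (p : Ω → ℝ) (c : ℝ) (f : Ω → ℝ) :
    pmean p (fun ω => c * f ω) = c * pmean p f := by
  rw [pmean, pmean, Finset.mul_sum]
  exact Finset.sum_congr rfl fun ω _ => by ring

lemma pmean_mono {Ω : Type*} [Fintype Ω] {p : Ω → ℝ} (hp : ∀ ω, 0 ≤ p ω) {f g : Ω → ℝ}
    (h : ∀ ω, f ω ≤ g ω) : pmean p f ≤ pmean p g :=
  Finset.sum_le_sum fun ω _ => mul_le_mul_of_nonneg_left (h ω) (hp ω)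

lemma pmean_nonneg {Ω : Type*} [Fintype Ω] {p : Ω → ℝ} (hp : ∀ ω, 0 ≤ p ω) {f : Ω → ℝ}
    (h : ∀ ω, 0 ≤ f ω) : 0 ≤ pmean p f :=
  Finset.sum_nonneg fun ω _ => mul_nonneg (hp ω) (h ω)

lemma minkowski_pmean {Ω ι : Type*} [Fintype Ω] [Fintype ι] {p : Ω → ℝ} (hp : ∀ ω, 0 ≤ p ω)
    {w : ι → ℝ} (hw : ∀ k, 0 ≤ w k) {h : ι → Ω → ℝ} (hh : ∀ k ω, 0 ≤ h k ω) {N : ι → ℝ}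
    (hN : ∀ k, 0 ≤ N k) (m : ℕ)
    (hhN : ∀ k, pmean p (fun ω => h k ω ^ (m + 1)) ≤ N k ^ (m + 1)) :
    pmean p (fun ω => pmean w (fun k => h k ω) ^ (m + 1)) ≤ pmean w N ^ (m + 1) := by
  refine minkowski_sum hp (h := fun k ω => w k * h k ω) (N := fun k => w k * N k)
    (fun k ω => mul_nonneg (hw k) (hh k ω)) (fun k => mul_nonneg (hw k) (hN k)) m
    (fun k => ?_) Finset.univ
  simp only [mul_pow]
  rw [pmean_mul_left]
  exact mul_le_mul_of_nonneg_left (hhN k) (pow_nonneg (hw k) _)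

/-! ### Product distributions -/

lemma isDist_prodDist {A : Type*} [Fintype A] {p : A → ℝ} (hp : IsDist p) (n : ℕ) :
    IsDist (prodDist p n) := by
  refine ⟨fun x => Finset.prod_nonneg fun i _ => hp.1 _, ?_⟩
  have := (Finset.prod_univ_sum (fun _ : Fin n => (Finset.univ : Finset A)) (fun _ a => p a)).symm
  simpa [prodDist, hp.2] using this

lemma pmean_const {Ω : Type*} [Fintype Ω] {p : Ω → ℝ} (hp : IsDist p) (c : ℝ) :
    pmean p (fun _ => c) = c := by
  rw [pmean, ← Finset.sum_mul, hp.2, one_mul]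

lemma pmean_comm {Ω ι : Type*} [Fintype Ω] [Fintype ι] (p : Ω → ℝ) (w : ι → ℝ)
    (f : Ω → ι → ℝ) :
    pmean p (fun ω => pmean w (f ω)) = pmean w (fun k => pmean p (fun ω => f ω k)) := by
  simp only [pmean, Finset.mul_sum]
  rw [Finset.sum_comm]
  exact Finset.sum_congr rfl fun k _ => Finset.sum_congr rfl fun ω _ => by ring

lemma pmean_prodDist_succ {A : Type*} [Fintype A] (p : A → ℝ) (n : ℕ)
    (f : (Fin (n + 1) → A) → ℝ) :
    pmean (prodDist p (n + 1)) f =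
      pmean (prodDist p n) (fun y => pmean p (fun a => f (Fin.cons a y))) := by
  rw [← pmean_comm p (prodDist p n) (fun a y => f (Fin.cons a y))]
  simp only [pmean, Finset.mul_sum]
  rw [← Fintype.sum_prod_type', ← (Fin.consEquiv (fun _ : Fin (n + 1) => A)).sum_comp]
  refine Finset.sum_congr rfl fun x _ => ?_
  simp [prodDist, Fin.prod_univ_succ, Fin.consEquiv, mul_assoc]

lemma pmean_prodDist_mix {A : Type*} [Fintype A] {p : A → ℝ} (hp : IsDist p) {n : ℕ}
    (H : Finset (Fin n)) (F : (Fin n → A) → ℝ) :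
    pmean (prodDist p n) (fun ξ => pmean (prodDist p n)
      (fun x => F (fun j => if j ∈ H then ξ j else x j))) = pmean (prodDist p n) F := by
  have hF : pmean (prodDist p n) F =
      pmean (prodDist p n) (fun y => pmean (prodDist p n) (fun _ => F y)) := by
    simp only [pmean_const (isDist_prodDist hp n)]
  rw [hF]
  simp only [pmean, Finset.mul_sum]
  rw [← Fintype.sum_prod_type', ← Fintype.sum_prod_type']
  let swap : (Fin n → A) × (Fin n → A) → (Fin n → A) × (Fin n → A) :=
    fun z => (fun j => if j ∈ H then z.1 j else z.2 j, fun j => if j ∈ H then z.2 j else z.1 j)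
  have hswap : Function.Involutive swap := by
    intro z
    ext j <;> by_cases hj : j ∈ H <;> simp [swap, hj]
  rw [← Equiv.sum_comp (hswap.toPerm swap)
    (fun z : (Fin n → A) × (Fin n → A) => prodDist p n z.1 * (prodDist p n z.2 * F z.1))]
  refine Finset.sum_congr rfl fun z _ => ?_
  simp only [Function.Involutive.coe_toPerm, swap, prodDist]
  rw [← mul_assoc, ← mul_assoc, ← Finset.prod_mul_distrib, ← Finset.prod_mul_distrib]
  congr 1
  refine Finset.prod_congr rfl fun j _ => ?_
  by_cases hj : j ∈ H <;> simp [hj, mul_comm]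

/-! ### Low-degree functions -/

lemma degLE_of_dependsOn {A : Type*} {n d : ℕ} {g : (Fin n → A) → ℝ} (h : DependsOnLE d g) :
    degLE d g := Submodule.subset_span h

lemma degLE_map {A : Type*} {n k d e : ℕ}
    (L : ((Fin n → A) → ℝ) →ₗ[ℝ] ((Fin k → A) → ℝ))
    (hL : ∀ g, DependsOnLE d g → degLE e (L g)) {f : (Fin n → A) → ℝ} (hf : degLE d f) :
    degLE e (L f) := by
  have : Submodule.span ℝ { g : (Fin n → A) → ℝ | DependsOnLE d g } ≤
      (Submodule.span ℝ { g : (Fin k → A) → ℝ | DependsOnLE e g }).comap L :=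
    Submodule.span_le.2 hL
  exact this hf

lemma degLE_zero_eq {A : Type*} {n : ℕ} {f : (Fin n → A) → ℝ} (hf : degLE 0 f)
    (x y : Fin n → A) : f x = f y := by
  induction hf using Submodule.span_induction with
  | mem g hg =>
    obtain ⟨J, hJ, h⟩ := hg
    exact h x y (by simp [Finset.card_eq_zero.1 (Nat.le_zero.1 hJ)])
  | zero => rfl
  | add f g _ _ hf hg => simp [hf, hg]
  | smul c f _ hf => simp [hf]

lemma card_preimage_succ_le {n : ℕ} (J : Finset (Fin (n + 1))) :
    (Finset.univ.filter fun j : Fin n => j.succ ∈ J).card ≤ (J.erase 0).card := by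
  refine Finset.card_le_card_of_injOn Fin.succ (fun j hj => ?_) (Fin.succ_injective n).injOn
  simpa using hj

lemma degLE_cons {A : Type*} {n d : ℕ} (a : A) {f : (Fin (n + 1) → A) → ℝ} (hf : degLE d f) :
    degLE d (fun y => f (Fin.cons a y)) := by
  refine degLE_map (LinearMap.funLeft ℝ ℝ (fun y : Fin n → A => Fin.cons (α := fun _ => A) a y))
    (fun g hg => degLE_of_dependsOn ?_) hf
  obtain ⟨J, hJ, h⟩ := hg
  refine ⟨Finset.univ.filter fun j : Fin n => j.succ ∈ J,
    (card_preimage_succ_le J).trans ((Finset.card_le_card (J.erase_subset 0)).trans hJ),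
    fun x y hxy => h _ _ fun i hi => ?_⟩
  cases i using Fin.cases with
  | zero => simp
  | succ j => simpa using hxy j (by simpa using hi)

lemma degLE_cons_sub_cons {A : Type*} {n d : ℕ} (a b : A) {f : (Fin (n + 1) → A) → ℝ}
    (hf : degLE (d + 1) f) :
    degLE d (fun y => f (Fin.cons a y) - f (Fin.cons b y)) := by
  refine degLE_map
    (LinearMap.funLeft ℝ ℝ (fun y : Fin n → A => Fin.cons (α := fun _ => A) a y) -
      LinearMap.funLeft ℝ ℝ (fun y : Fin n → A => Fin.cons (α := fun _ => A) b y))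
    (fun g hg => ?_) hf
  obtain ⟨J, hJ, h⟩ := hg
  by_cases h0 : (0 : Fin (n + 1)) ∈ J
  · refine degLE_of_dependsOn ⟨Finset.univ.filter fun j : Fin n => j.succ ∈ J,
      (card_preimage_succ_le J).trans ?_, fun x y hxy => ?_⟩
    · rw [Finset.card_erase_of_mem h0]; omega
    · have : ∀ c : A, g (Fin.cons c x) = g (Fin.cons c y) := fun c => h _ _ fun i hi => by
        cases i using Fin.cases with
        | zero => simp
        | succ j => simpa using hxy j (by simpa using hi)
      simp [LinearMap.funLeft_apply, this]
  · have : (LinearMap.funLeft ℝ ℝ (fun y : Fin n → A => Fin.cons (α := fun _ => A) a y) -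
      LinearMap.funLeft ℝ ℝ (fun y : Fin n → A => Fin.cons (α := fun _ => A) b y)) g = 0 := by
      ext y
      simp only [LinearMap.sub_apply, Pi.sub_apply, LinearMap.funLeft_apply, Pi.zero_apply,
        sub_eq_zero]
      refine h _ _ fun i hi => ?_
      cases i using Fin.cases with
      | zero => exact absurd hi h0
      | succ j => simp
    rw [this]
    exact Submodule.zero_mem _

lemma degLE_pmean {A ι : Type*} [Fintype ι] {n d : ℕ} (w : ι → ℝ)
    {F : ι → (Fin n → A) → ℝ} (hF : ∀ k, degLE d (F k)) :
    degLE d (fun y => pmean w (fun k => F k y)) := by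
  have : (fun y => pmean w (fun k => F k y)) = ∑ k, w k • F k := by
    ext y; simp [pmean]
  rw [this]
  exact Submodule.sum_mem _ fun k _ => Submodule.smul_mem _ _ (hF k)

lemma degLE_sub_update {A : Type*} {n d : ℕ} {f : (Fin n → A) → ℝ} (hf : degLE d f)
    (i : Fin n) (a : A) : degLE d (fun x => f x - f (Function.update x i a)) := by
  refine degLE_map (LinearMap.id - LinearMap.funLeft ℝ ℝ (fun x => Function.update x i a))
    (fun g hg => degLE_of_dependsOn ?_) hf
  obtain ⟨J, hJ, h⟩ := hg
  refine ⟨J, hJ, fun x y hxy => ?_⟩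
  have h2 : g (Function.update x i a) = g (Function.update y i a) := h _ _ fun j hj => by
    rcases eq_or_ne j i with rfl | hji
    · simp
    · simpa [hji] using hxy j hj
  simp [LinearMap.funLeft_apply, h x y hxy, h2]

/-- Hypercontractivity for low-degree functions on a product space, at even exponents. -/
lemma hypercontractive {A : Type*} [Fintype A] {p : A → ℝ} (hp : IsDist p) {α : ℝ}
    (hα : 0 < α) (hα2 : α ≤ 1 / 2) (hmin : ∀ a, p a = 0 ∨ α ≤ p a) (m : ℕ) {n : ℕ} (d : ℕ)
    (f : (Fin n → A) → ℝ) (hf : degLE d f) :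
    pmean (prodDist p n) (fun x => (f x ^ 2) ^ (m + 1)) ≤
      (((2 * m + 1) / α) ^ d * pmean (prodDist p n) (fun x => f x ^ 2)) ^ (m + 1) := by
  set κ : ℝ := (2 * m + 1) / α with hκ
  have hκ1 : 1 ≤ κ := by
    rw [hκ, le_div_iff₀ hα]; nlinarith [(Nat.cast_nonneg m : (0 : ℝ) ≤ m)]
  induction n generalizing d with
  | zero =>
    have e : ∀ g : (Fin 0 → A) → ℝ, pmean (prodDist p 0) g = g Fin.elim0 := by
      intro g
      rw [pmean, Fintype.sum_unique, prodDist, Finset.univ_eq_empty, Finset.prod_empty, one_mul]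
      congr 1
    rw [e, e]
    exact pow_le_pow_left₀ (sq_nonneg _)
      (le_mul_of_one_le_left (sq_nonneg _) (one_le_pow₀ hκ1)) _
  | succ n ih =>
    obtain _ | d := d
    · have hD := isDist_prodDist hp (n + 1)
      obtain ⟨c, hc⟩ : ∃ c, ∀ x, f x = c := by
        rcases isEmpty_or_nonempty (Fin (n + 1) → A) with h | ⟨⟨x⟩⟩
        · exact ⟨0, fun x => h.elim x⟩
        · exact ⟨f x, fun y => degLE_zero_eq hf y x⟩
      simp only [hc, pmean_const hD, pow_zero, one_mul, le_refl]
    have hD := isDist_prodDist hp n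
    set f₀ : (Fin n → A) → ℝ := fun y => pmean p (fun a => f (Fin.cons a y)) with hf₀
    set f₁ : A → (Fin n → A) → ℝ := fun a y => f (Fin.cons a y) - f₀ y with hf₁
    have hf₁' : ∀ a, f₁ a = fun y => pmean p (fun b => f (Fin.cons a y) - f (Fin.cons b y)) := by
      intro a
      ext y
      simp only [hf₁, hf₀, pmean, mul_sub, Finset.sum_sub_distrib, ← Finset.sum_mul, hp.2, one_mul]
    have hd₀ : degLE (d + 1) f₀ := degLE_pmean p fun a => degLE_cons a hf
    have hd₁ : ∀ a, degLE d (f₁ a) := fun a => by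
      rw [hf₁']; exact degLE_pmean p fun b => degLE_cons_sub_cons a b hf
    have hmean : ∀ y, pmean p (fun a => f₁ a y) = 0 := by
      intro y
      simp only [hf₁, pmean, mul_sub, Finset.sum_sub_distrib, ← Finset.sum_mul, hp.2, one_mul]
      simp [hf₀, pmean]
    have hcons : ∀ a y, f (Fin.cons a y) = f₀ y + f₁ a y := fun a y => by simp [hf₁]
    have hsq : ∀ y, pmean p (fun a => f (Fin.cons a y) ^ 2) =
        f₀ y ^ 2 + pmean p (fun a => f₁ a y ^ 2) := by
      intro y
      have e : ∀ a, p a * f (Fin.cons a y) ^ 2 =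
          f₀ y ^ 2 * p a + 2 * f₀ y * (p a * f₁ a y) + p a * f₁ a y ^ 2 := fun a => by
        rw [hcons]; ring
      have h0 : ∑ a, p a * f₁ a y = 0 := hmean y
      simp only [pmean, e, Finset.sum_add_distrib, ← Finset.mul_sum, hp.2, h0]
      ring
    have hnorm : pmean (prodDist p (n + 1)) (fun x => f x ^ 2) =
        pmean (prodDist p n) (fun y => f₀ y ^ 2) +
          pmean p (fun a => pmean (prodDist p n) (fun y => f₁ a y ^ 2)) := by
      rw [pmean_prodDist_succ, ← pmean_comm (prodDist p n) p (fun y a => f₁ a y ^ 2)]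
      simp only [hsq]
      simp only [pmean, mul_add, Finset.sum_add_distrib]
    have hstep : ∀ y, pmean p (fun a => (f (Fin.cons a y) ^ 2) ^ (m + 1)) ≤
        (f₀ y ^ 2 + pmean p (fun a => κ * f₁ a y ^ 2)) ^ (m + 1) := by
      intro y
      simp only [hcons, ← pow_mul]
      rw [pmean_mul_left]
      exact one_variable hp hα hα2 hmin (fun a => f₁ a y) (hmean y) (f₀ y) m
    rw [pmean_prodDist_succ, hnorm]
    refine (pmean_mono hD.1 hstep).trans ?_
    have hκ0 : 0 ≤ κ := by linarith
    have hN₀ : 0 ≤ pmean (prodDist p n) (fun y => f₀ y ^ 2) :=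
      pmean_nonneg hD.1 fun y => sq_nonneg _
    have hN₁ : ∀ a, 0 ≤ pmean (prodDist p n) (fun y => f₁ a y ^ 2) :=
      fun a => pmean_nonneg hD.1 fun y => sq_nonneg _
    have hsum : pmean (prodDist p n) (fun y => pmean p (fun a => κ * f₁ a y ^ 2) ^ (m + 1)) ≤
        pmean p (fun a => κ ^ (d + 1) * pmean (prodDist p n) (fun y => f₁ a y ^ 2)) ^ (m + 1) := by
      refine minkowski_pmean hD.1 hp.1 (h := fun a y => κ * f₁ a y ^ 2)
        (fun a y => by positivity) (fun a => mul_nonneg (by positivity) (hN₁ a)) m fun a => ?_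
      simp only [mul_pow κ]
      rw [pmean_mul_left, pow_succ κ d, mul_comm (κ ^ d), mul_assoc, mul_pow κ]
      exact mul_le_mul_of_nonneg_left (ih d _ (hd₁ a)) (by positivity)
    refine (minkowski_two hD.1 (fun y => sq_nonneg _)
      (fun y => pmean_nonneg hp.1 fun a => by positivity) (by positivity)
      (pmean_nonneg hp.1 fun a => mul_nonneg (by positivity) (hN₁ a)) m
      (ih (d + 1) _ hd₀) hsum).trans (le_of_eq ?_)
    rw [pmean_mul_left, ← mul_add]

/-! ### Influences of restrictions -/

lemma influence_eq {A : Type*} [Fintype A] {n : ℕ} (p : A → ℝ) (i : Fin n)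
    (f : (Fin n → A) → ℝ) :
    influence p i f = pmean p (fun a => 1 / 2 *
      pmean (prodDist p n) (fun x => (f x - f (Function.update x i a)) ^ 2)) := by
  rw [pmean_mul_left, ← pmean_comm (prodDist p n) p, influence]
  congr 1
  simp only [pmean, prodDist, Finset.mul_sum, mul_assoc]

lemma influence_nonneg {A : Type*} [Fintype A] {p : A → ℝ} (hp : IsDist p) {n : ℕ} (i : Fin n)
    (f : (Fin n → A) → ℝ) : 0 ≤ influence p i f := by
  rw [influence_eq]
  exact pmean_nonneg hp.1 fun a => mul_nonneg (by norm_num)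
    (pmean_nonneg (isDist_prodDist hp n).1 fun x => sq_nonneg _)

lemma influence_restrictFn {A : Type*} [Fintype A] {n : ℕ} (p : A → ℝ) {H : Finset (Fin n)}
    {i : Fin n} (hi : i ∉ H) (P : (Fin n → A) → ℝ) (ξ : Fin n → A) :
    influence p i (restrictFn H ξ P) = pmean p (fun a => 1 / 2 *
      pmean (prodDist p n) (fun x =>
        (fun z => (P z - P (Function.update z i a)) ^ 2)
          (fun j => if j ∈ H then ξ j else x j))) := by
  rw [influence_eq]
  refine Finset.sum_congr rfl fun a _ => ?_
  have : ∀ x : Fin n → A, (fun j => if j ∈ H then ξ j else Function.update x i a j) =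
      Function.update (fun j => if j ∈ H then ξ j else x j) i a := by
    intro x
    ext j
    rcases eq_or_ne j i with rfl | hji
    · simp [hi]
    · simp [hji]
  simp only [restrictFn, this]

/-- Moments of the influence of a random restriction, given moment bounds for low-degree
functions. -/
lemma moment_influence_restrictFn {A : Type*} [Fintype A] {p : A → ℝ} (hp : IsDist p) {n d : ℕ}
    {P : (Fin n → A) → ℝ} (hP : degLE d P) {H : Finset (Fin n)} {i : Fin n} (hi : i ∉ H)
    (m : ℕ) {B : ℝ} (hB : 0 ≤ B)
    (hyp : ∀ f : (Fin n → A) → ℝ, degLE d f →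
      pmean (prodDist p n) (fun x => (f x ^ 2) ^ (m + 1)) ≤
        (B * pmean (prodDist p n) (fun x => f x ^ 2)) ^ (m + 1)) :
    pmean (prodDist p n) (fun ξ => influence p i (restrictFn H ξ P) ^ (m + 1)) ≤
      (B * influence p i P) ^ (m + 1) := by
  have hD := isDist_prodDist hp n
  rw [influence_eq p i P, ← pmean_mul_left]
  simp only [influence_restrictFn p hi P]
  refine minkowski_pmean hD.1 hp.1 (fun a ξ => mul_nonneg (by norm_num)
    (pmean_nonneg hD.1 fun x => sq_nonneg _)) (fun a => mul_nonneg hB (mul_nonneg (by norm_num)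
    (pmean_nonneg hD.1 fun x => sq_nonneg _))) m fun a => ?_
  simp only [mul_pow (1 / 2 : ℝ)]
  rw [pmean_mul_left, mul_left_comm, mul_pow (1 / 2 : ℝ)]
  refine mul_le_mul_of_nonneg_left ?_ (by positivity)
  refine le_trans ?_ (hyp _ (degLE_sub_update hP i a))
  rw [← pmean_prodDist_mix hp H (fun z => ((P z - P (Function.update z i a)) ^ 2) ^ (m + 1))]
  refine pmean_mono hD.1 fun ξ => ?_
  exact Real.pow_arith_mean_le_arith_mean_pow Finset.univ _ _ (fun x _ => hD.1 x) hD.2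
    (fun x _ => sq_nonneg _) (m + 1)

/-- Markov's inequality for a power. -/
lemma pprob_le_of_moment {Ω : Type*} [Fintype Ω] {p : Ω → ℝ} (hp : IsDist p) {f : Ω → ℝ}
    (hf : ∀ ω, 0 ≤ f ω) {B I t : ℝ} (hI : 0 ≤ I) (hB : 0 ≤ B) (ht : 0 < t) (m : ℕ)
    (h : pmean p (fun ω => f ω ^ (m + 1)) ≤ (B * I) ^ (m + 1)) :
    pprob p (fun ω => f ω > t * I) ≤ (B / t) ^ (m + 1) := by
  have hnn : ∀ ω ∈ Finset.univ, 0 ≤ p ω * f ω ^ (m + 1) :=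
    fun ω _ => mul_nonneg (hp.1 ω) (pow_nonneg (hf ω) _)
  rcases hI.eq_or_lt with rfl | hI
  · refine le_trans (le_of_eq (Finset.sum_eq_zero fun ω _ => ?_)) (by positivity)
    have h0 := (Finset.sum_eq_zero_iff_of_nonneg hnn).1
      (le_antisymm (by simpa [pmean] using h) (Finset.sum_nonneg hnn)) ω (Finset.mem_univ ω)
    split_ifs with hω
    · rw [mul_zero] at hω
      exact (mul_eq_zero.1 h0).resolve_right (pow_pos hω _).ne'
    · rfl
  · have htI : 0 < t * I := mul_pos ht hI
    have e : (B / t) ^ (m + 1) = (B * I) ^ (m + 1) / (t * I) ^ (m + 1) := by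
      rw [← div_pow, mul_div_mul_right _ _ hI.ne']
    rw [e, le_div_iff₀ (by positivity)]
    refine le_trans ?_ h
    rw [pprob, Finset.sum_mul]
    refine Finset.sum_le_sum fun ω hω => ?_
    split_ifs with hlt
    · exact mul_le_mul_of_nonneg_left (pow_le_pow_left₀ htI.le hlt.le _) (hp.1 ω)
    · simpa using hnn ω hω

lemma minAtom_pos_and_le {A : Type*} [Fintype A] {p : A → ℝ} (hp : IsDist p) :
    0 < minAtom p ∧ ∀ a, p a = 0 ∨ minAtom p ≤ p a := by
  have hfin : { x | ∃ a, p a = x ∧ 0 < x }.Finite :=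
    (Set.finite_range p).subset fun x ⟨a, ha, _⟩ => ⟨a, ha⟩
  have hne : { x | ∃ a, p a = x ∧ 0 < x }.Nonempty := by
    by_contra h
    have h0 : ∀ a, p a = 0 := fun a => by
      by_contra ha
      exact h ⟨p a, a, rfl, lt_of_le_of_ne (hp.1 a) (Ne.symm ha)⟩
    simpa [h0] using hp.2
  refine ⟨?_, fun a => ?_⟩
  · obtain ⟨_, _, h⟩ := hne.csInf_mem hfin
    exact h
  · rcases (hp.1 a).eq_or_lt with h | h
    · exact Or.inl h.symm
    · exact Or.inr (csInf_le hfin.bddBelow ⟨a, rfl, h⟩)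

lemma three_le_C4 {α : ℝ} (hα : 0 < α) (hα2 : α ≤ 1 / 2) : 3 ≤ C4 α := by
  rw [C4]
  split_ifs with h
  · exact le_rfl
  have hlt : α < 1 / 2 := lt_of_le_of_ne hα2 h
  have hA : 1 < (1 - α) / α := by rw [lt_div_iff₀ hα]; linarith
  set A := (1 - α) / α
  have hA0 : 0 ≤ A := by linarith
  have hs : 1 < A ^ ((1 : ℝ) / 4) := Real.one_lt_rpow hA (by norm_num)
  have e : A ^ ((3 : ℝ) / 4) = (A ^ ((1 : ℝ) / 4)) ^ 3 := by
    rw [← Real.rpow_natCast, ← Real.rpow_mul hA0]; norm_num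
  rw [Real.rpow_neg hA0, Real.rpow_neg hA0, e]
  set s := A ^ ((1 : ℝ) / 4)
  have hs0 : 0 < s := by linarith
  have hinv : s⁻¹ < 1 := inv_lt_one_of_one_lt₀ hs
  have hmul : s * s⁻¹ = 1 := mul_inv_cancel₀ hs0.ne'
  rw [le_div_iff₀ (by linarith), ← inv_pow]
  set v := s⁻¹
  have : s ^ 3 - v ^ 3 = (s - v) * ((s - v) ^ 2 + 3 * (s * v)) := by ring
  rw [this, hmul]
  nlinarith [mul_nonneg (show 0 ≤ s - v by linarith) (sq_nonneg (s - v))]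

/-- The choice of moment: the resulting tail is exponentially small. -/
lemma div_pow_le_exp_neg {m : ℕ} (hm : 1 ≤ m) {q : ℝ} (hq : (m + 1 : ℝ) ≤ q)
    (hq2 : q < (m + 1 : ℝ) + 1) :
    ((2 * m + 1) / (3 * Real.exp 1 * q)) ^ (m + 1) ≤ Real.exp (-q) := by
  have hm' : (1 : ℝ) ≤ m := by exact_mod_cast hm
  have hM : (0 : ℝ) < m + 1 := by linarith
  have hq0 : 0 < q := by linarith
  have h1 : (2 * m + 1) / (3 * Real.exp 1 * q) ≤ Real.exp (-q / (m + 1)) := by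
    have h2 : 2 - q / (m + 1) ≤ Real.exp (1 - q / (m + 1)) := by
      linarith [Real.add_one_le_exp (1 - q / (m + 1 : ℝ))]
    have h3 : (2 * m + 1 : ℝ) ≤ 3 * q * (2 - q / (m + 1)) := by
      have : 3 * q * (2 - q / (m + 1)) = 3 * q * (2 * (m + 1) - q) / (m + 1) := by
        field_simp
      rw [this, le_div_iff₀ hM]
      nlinarith [mul_nonneg (sub_nonneg.2 hq) (sub_nonneg.2 hq2.le)]
    rw [div_le_iff₀ (by positivity)]
    have h4 : Real.exp (1 - q / (m + 1)) = Real.exp (-q / (m + 1)) * Real.exp 1 := by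
      rw [← Real.exp_add]; ring_nf
    nlinarith [mul_le_mul_of_nonneg_left h2 (show 0 ≤ 3 * q by positivity)]
  calc _ ≤ Real.exp (-q / (m + 1)) ^ (m + 1) := pow_le_pow_left₀ (by positivity) h1 _
    _ = Real.exp (-q) := by
      rw [← Real.exp_nat_mul]; congr 1; push_cast; field_simp

/-- Concentration of influences under random restrictions (Claim 5.4): for a
degree-`d` function `P`, for every `r ≥ e^d` and unrestricted coordinate `i`,
`Pr_ξ[Inf_i(P_ξ) > r · C₄(α)^d · Inf_i(P)] ≤ exp(-c r^{1/d})` with `c = α d / e`. -/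
theorem stmt6 {A : Type*} [Fintype A] (μA : A → ℝ) (hμA : IsDist μA)
    (hα : minAtom μA ≤ 1 / 2) {n : ℕ} (d : ℕ) (P : (Fin n → A) → ℝ) (hP : degLE d P)
    (H : Finset (Fin n)) (i : Fin n) (hi : i ∉ H) (r : ℝ) (hr : Real.exp d ≤ r) :
    pprob (prodDist μA n)
      (fun ξ => influence μA i (restrictFn H ξ P) >
        r * C4 (minAtom μA) ^ d * influence μA i P)
      ≤ Real.exp (-(minAtom μA * d / Real.exp 1) * r ^ ((1 : ℝ) / (d : ℝ))) := by
  have hD := isDist_prodDist hμA n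
  obtain ⟨hα0, hmin⟩ := minAtom_pos_and_le hμA
  have hC := three_le_C4 hα0 hα
  set α := minAtom μA
  set C := C4 α
  have hI := influence_nonneg hμA i P
  have hr0 : 0 < r := (Real.exp_pos _).trans_le hr
  have hf : ∀ ξ, 0 ≤ influence μA i (restrictFn H ξ P) := fun ξ => influence_nonneg hμA i _
  rcases Nat.eq_zero_or_pos d with rfl | hd
  · have h1 : ∀ E, pprob (prodDist μA n) E ≤ 1 := fun E => by
      rw [← hD.2]
      refine Finset.sum_le_sum fun ξ _ => ?_
      split_ifs
      · exact le_rfl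
      · exact hD.1 ξ
    simpa using h1 _
  have hdR : (0 : ℝ) < d := by exact_mod_cast hd
  set ρ := r ^ ((1 : ℝ) / (d : ℝ)) with hρ
  have hρr : r = ρ ^ d := by
    rw [hρ, ← Real.rpow_natCast, ← Real.rpow_mul hr0.le]
    field_simp
    simp
  have hρe : Real.exp 1 ≤ ρ := by
    have := Real.rpow_le_rpow (Real.exp_pos _).le hr (show (0 : ℝ) ≤ 1 / d by positivity)
    rwa [← Real.exp_mul, mul_one_div_cancel hdR.ne'] at this
  have hρ0 : 0 < ρ := (Real.exp_pos 1).trans_le hρe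
  set q := α * ρ / Real.exp 1 with hq
  have hgoal : Real.exp (-(α * d / Real.exp 1) * ρ) = Real.exp (-q) ^ d := by
    rw [← Real.exp_nat_mul, hq]; ring_nf
  have hC0 : 0 < C := by linarith
  have ht : 0 < r * C ^ d := by positivity
  rw [hgoal]
  rcases lt_or_ge q 2 with hq2 | hq2
  · have hmom := moment_influence_restrictFn hμA hP hi 0 zero_le_one (fun f _ => by simp)
    refine (pprob_le_of_moment hD hf hI zero_le_one ht 0 hmom).trans ?_
    rw [hρr, ← mul_pow, zero_add, pow_one, ← one_div_pow]
    refine pow_le_pow_left₀ (by positivity) ?_ d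
    rw [Real.exp_neg, one_div]
    refine inv_anti₀ (Real.exp_pos q) ?_
    calc Real.exp q ≤ Real.exp 2 := Real.exp_le_exp.2 hq2.le
      _ = Real.exp 1 * Real.exp 1 := by rw [← Real.exp_add]; norm_num
      _ ≤ ρ * C := mul_le_mul hρe (by linarith [Real.exp_one_lt_d9]) (Real.exp_pos _).le hρ0.le
  · obtain ⟨m, hm⟩ : ∃ m, ⌊q⌋₊ = m + 1 := Nat.exists_eq_succ_of_ne_zero (by
      have : 2 ≤ ⌊q⌋₊ := Nat.le_floor (by exact_mod_cast hq2)
      omega)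
    have hm1 : 1 ≤ m := by
      have : 2 ≤ ⌊q⌋₊ := Nat.le_floor (by exact_mod_cast hq2)
      omega
    have hmq : (m + 1 : ℝ) ≤ q := by
      have := Nat.floor_le (show 0 ≤ q by linarith)
      rw [hm] at this; exact_mod_cast this
    have hqm : q < (m + 1 : ℝ) + 1 := by
      have := Nat.lt_floor_add_one q
      rw [hm] at this; exact_mod_cast this
    have hmom := moment_influence_restrictFn hμA hP hi m
      (B := ((2 * m + 1) / α) ^ d) (by positivity)
      (hypercontractive hμA hα0 hα hmin m d)
    refine (pprob_le_of_moment hD hf hI (by positivity) ht m hmom).trans ?_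
    rw [hρr, ← mul_pow, ← div_pow, ← pow_mul, mul_comm d, pow_mul]
    refine pow_le_pow_left₀ (by positivity) (le_trans ?_ (div_pow_le_exp_neg hm1 hmq hqm)) d
    refine pow_le_pow_left₀ (by positivity) ?_ _
    rw [div_div]
    refine div_le_div_of_nonneg_left (by positivity) (by positivity) ?_
    have : 3 * Real.exp 1 * q = α * ρ * 3 := by
      rw [hq]; field_simp
    rw [this, ← mul_assoc]
    exact mul_le_mul_of_nonneg_left hC (by positivity)

end NIS
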